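/- (Lohrey–Steinberg.) The right-angled Artin group A(P_4) contains a finitely generated submonoid with undecidable membership problem: there is a finite set S of words over the generators a, b, c, d of A(P_4) and their inverses such that no computable function on words decides, for an input word w over the generators and their inverses, whether the image of w in A(P_4) under the canonical monoid homomorphism lies in the submonoid of A(P_4) generated by the images of the words in S. -/

import Mathlib

/-- Relations of the right-angled Artin group of a simplicial graph: commutators of adjacent vertices. -/
def raagRels {V : Type*} (G : SimpleGraph V) : Set (FreeGroup V) :=
  {r | ∃ u v : V, G.Adj u v ∧
    r = FreeGroup.of u * FreeGroup.of v * (FreeGroup.of u)⁻¹ * (FreeGroup.of v)⁻¹}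

/-- The right-angled Artin group of a simplicial graph. -/
abbrev RAAG {V : Type*} (G : SimpleGraph V) := PresentedGroup (raagRels G)

instance : Primcodable (FreeMonoid (Fin 4 × Bool)) :=
  inferInstanceAs (Primcodable (List (Fin 4 × Bool)))

/-- The canonical monoid homomorphism from the free monoid over the alphabet of the four
generators of `A(P₄)` and their formal inverses (a letter `(i, true)` stands for the
generator `i`, and `(i, false)` for its inverse) onto `A(P₄)`. -/
def wordEval : FreeMonoid (Fin 4 × Bool) →* RAAG (SimpleGraph.pathGraph 4) :=
  FreeMonoid.lift fun p =>
    if p.2 then PresentedGroup.of p.1 else (PresentedGroup.of p.1)⁻¹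

/-! ### Register programs -/

namespace P4

/-- Instructions of a register machine. -/
inductive RInstr | skip | inc (i : ℕ) | dec (i : ℕ) | tz (i : ℕ)
  deriving Encodable

/-- Programs: regular expressions over instructions (without sums). -/
inductive RProg | atom (i : RInstr) | seq (P Q : RProg) | star (P : RProg)
  deriving Encodable

open RInstr RProg Function

/-- Semantics of instructions. -/
def RInstr.rel : RInstr → (ℕ → ℕ) → (ℕ → ℕ) → Prop
  | skip, ρ, ρ' => ρ' = ρ
  | inc i, ρ, ρ' => ρ' = update ρ i (ρ i + 1)
  | dec i, ρ, ρ' => ρ i ≠ 0 ∧ ρ' = update ρ i (ρ i - 1)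
  | tz i, ρ, ρ' => ρ i = 0 ∧ ρ' = ρ

def RProg.rel : RProg → (ℕ → ℕ) → (ℕ → ℕ) → Prop
  | atom i, ρ, ρ' => i.rel ρ ρ'
  | seq P Q, ρ, ρ' => ∃ ρ₁, P.rel ρ ρ₁ ∧ Q.rel ρ₁ ρ'
  | star P, ρ, ρ' => Relation.ReflTransGen P.rel ρ ρ'

def wh (i : ℕ) (P : RProg) : RProg := seq (star (seq (atom (dec i)) P)) (atom (tz i))

theorem wh_zero {i P} {ρ ρ' : ℕ → ℕ} (h : ρ i = 0) : (wh i P).rel ρ ρ' ↔ ρ' = ρ := by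
  constructor
  · rintro ⟨ρ₁, h1, h2, h3⟩
    rcases Relation.ReflTransGen.cases_head h1 with rfl | ⟨ρ₂, ⟨ρ₃, ⟨h4, _⟩, _⟩, _⟩
    · exact h3
    · exact absurd h h4
  · rintro rfl
    exact ⟨_, Relation.ReflTransGen.refl, h, rfl⟩

theorem wh_succ {i P k} {ρ ρ' : ℕ → ℕ} (h : ρ i = k + 1) :
    (wh i P).rel ρ ρ' ↔ ∃ ρ₁, P.rel (update ρ i k) ρ₁ ∧ (wh i P).rel ρ₁ ρ' := by
  constructor
  · rintro ⟨ρ₁, h1, h2, h3⟩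
    rcases Relation.ReflTransGen.cases_head h1 with rfl | ⟨ρ₂, ⟨ρ₃, ⟨h4, h5⟩, h6⟩, h7⟩
    · omega
    · subst h5
      refine ⟨ρ₂, ?_, ρ₁, h7, h2, h3⟩
      simpa [h] using h6
  · rintro ⟨ρ₁, h1, ρ₂, h2, h3⟩
    refine ⟨ρ₂, Relation.ReflTransGen.head ⟨update ρ i k, ⟨by omega, ?_⟩, h1⟩ h2, h3⟩
    simp [h]

theorem seq_det {P Q : RProg} {ρ ρ₁ ρ' : ℕ → ℕ} (h : ∀ σ, P.rel ρ σ ↔ σ = ρ₁) :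
    (seq P Q).rel ρ ρ' ↔ Q.rel ρ₁ ρ' := by
  simp [RProg.rel, h]

/-- clear register `i` -/
def clr (i : ℕ) : RProg := wh i (atom skip)

theorem clr_rel {i} {ρ : ℕ → ℕ} : ∀ ρ', (clr i).rel ρ ρ' ↔ ρ' = update ρ i 0 := by
  obtain ⟨k, hk⟩ : ∃ k, ρ i = k := ⟨_, rfl⟩
  induction k generalizing ρ with
  | zero => intro ρ'; rw [clr, wh_zero hk, ← hk, update_eq_self]
  | succ k ih =>
    intro ρ'
    rw [clr, wh_succ hk]
    simp only [RProg.rel, RInstr.rel, exists_eq_left]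
    rw [← clr, ih (by simp)]
    simp

/-- move register `i` into `j` -/
def mv (i j : ℕ) : RProg := wh i (atom (inc j))

theorem mv_rel {i j} (hij : i ≠ j) {ρ : ℕ → ℕ} :
    ∀ ρ', (mv i j).rel ρ ρ' ↔ ρ' = update (update ρ j (ρ j + ρ i)) i 0 := by
  obtain ⟨k, hk⟩ : ∃ k, ρ i = k := ⟨_, rfl⟩
  induction k generalizing ρ with
  | zero =>
    intro ρ'; rw [mv, wh_zero hk, hk]
    have : update (update ρ j (ρ j + 0)) i 0 = ρ := by
      funext x; simp only [update_apply]; split_ifs <;> simp_all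
    rw [this]
  | succ k ih =>
    intro ρ'
    rw [mv, wh_succ hk]
    simp only [RProg.rel, RInstr.rel, exists_eq_left]
    rw [← mv, ih (by simp [update_apply, hij])]
    apply Eq.congr_right
    funext x; simp only [update_apply]; split_ifs <;> grind

/-- add register `i` to both `j` and `t`, clearing it. -/
def mv2 (i j t : ℕ) : RProg := wh i (seq (atom (inc j)) (atom (inc t)))

theorem mv2_rel {i j t} (hij : i ≠ j) (hit : i ≠ t) (hjt : j ≠ t) {ρ : ℕ → ℕ} :
    ∀ ρ', (mv2 i j t).rel ρ ρ' ↔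
      ρ' = update (update (update ρ j (ρ j + ρ i)) t (ρ t + ρ i)) i 0 := by
  obtain ⟨k, hk⟩ : ∃ k, ρ i = k := ⟨_, rfl⟩
  induction k generalizing ρ with
  | zero =>
    intro ρ'; rw [mv2, wh_zero hk, hk]
    apply Eq.congr_right
    funext x; simp only [update_apply]; split_ifs <;> simp_all
  | succ k ih =>
    intro ρ'
    rw [mv2, wh_succ hk]
    simp only [RProg.rel, RInstr.rel, exists_eq_left]
    have := @ih (update (update (update ρ i k) j (update ρ i k j + 1)) t
      (update (update ρ i k) j (update ρ i k j + 1) t + 1)) (by grind) ρ'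
    rw [← mv2, this]
    apply Eq.congr_right
    funext x; simp only [update_apply]; split_ifs <;> grind

/-- copy register `i` to `j` using scratch `t` -/
def cp (i j t : ℕ) : RProg := seq (mv2 i j t) (mv t i)

theorem cp_rel {i j t} (hij : i ≠ j) (hit : i ≠ t) (hjt : j ≠ t) {ρ : ℕ → ℕ} (ht : ρ t = 0) :
    ∀ ρ', (cp i j t).rel ρ ρ' ↔ ρ' = update ρ j (ρ j + ρ i) := by
  intro ρ'
  rw [cp, seq_det (mv2_rel hij hit hjt), mv_rel hit.symm]
  apply Eq.congr_right
  funext x; simp only [update_apply]; split_ifs <;> grind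

/-- `f` is computed by register programs. -/
def RComp {n : ℕ} (f : List.Vector ℕ n → ℕ) : Prop :=
  ∀ (xs : Fin n → ℕ) (z s : ℕ), (∀ i, xs i < s) → z < s → (∀ i, xs i ≠ z) →
    ∃ P : RProg, ∀ ρ : ℕ → ℕ, (∀ j, s ≤ j → ρ j = 0) → ρ z = 0 →
      ∀ ρ', P.rel ρ ρ' ↔ ρ' = update ρ z (f (List.Vector.ofFn fun i => ρ (xs i)))

theorem rcomp_zero : @RComp 0 fun _ => 0 := by
  intro xs z s _ hz _
  refine ⟨atom skip, fun ρ _ h ρ' => ?_⟩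
  simp only [RProg.rel, RInstr.rel]
  rw [← h, update_eq_self]

theorem rcomp_get {n} (i : Fin n) : @RComp n fun v => v.get i := by
  intro xs z s hs hz hx
  refine ⟨cp (xs i) z s, fun ρ h0 h ρ' => ?_⟩
  rw [cp_rel (hx i) (hs i).ne hz.ne (h0 s le_rfl)]
  simp [h]

theorem rcomp_succ : @RComp 1 fun v => Nat.succ v.head := by
  intro xs z s hs hz hx
  refine ⟨seq (cp (xs 0) z s) (atom (inc z)), fun ρ h0 h ρ' => ?_⟩
  rw [seq_det (cp_rel (hx 0) (hs 0).ne hz.ne (h0 s le_rfl))]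
  simp [RProg.rel, RInstr.rel, h, ← List.Vector.get_zero]

theorem rcomp_prec {n} {f : List.Vector ℕ n → ℕ} {g : List.Vector ℕ (n + 2) → ℕ}
    (hf : RComp f) (hg : RComp g) :
    RComp fun v : List.Vector ℕ (n + 1) =>
      v.head.rec (f v.tail) fun y IH => g (y ::ᵥ IH ::ᵥ v.tail) := by
  intro xs z s hs hz hx
  obtain ⟨Pf, hPf⟩ := hf (fun i => xs i.succ) z (s + 3) (fun i => by have := hs i.succ; omega)
    (by omega) (fun i => hx _)
  obtain ⟨Pg, hPg⟩ := hg (Fin.cons (s + 1) (Fin.cons z fun i => xs i.succ)) (s + 2) (s + 3)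
    (by
      intro i
      refine Fin.cases ?_ (fun i => Fin.cases ?_ (fun i => ?_) i) i
      · simp
      · simp; omega
      · have := hs i.succ
        simp; omega)
    (by omega)
    (by
      intro i
      refine Fin.cases ?_ (fun i => Fin.cases ?_ (fun i => ?_) i) i
      · simp
      · simp; omega
      · have := hs i.succ
        simp; omega)
  let body : RProg := seq Pg (seq (clr z) (seq (mv (s + 2) z) (atom (inc (s + 1)))))
  -- the states in the loop
  let st : (ℕ → ℕ) → ℕ → ℕ → ℕ → (ℕ → ℕ) := fun ρ t i a =>
    update (update (update ρ z a) s t) (s + 1) i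
  have hloop : ∀ ρ : ℕ → ℕ, (∀ j, s ≤ j → ρ j = 0) → ρ z = 0 → ∀ (R : ℕ → ℕ),
      (∀ y, R (y + 1) = g (y ::ᵥ R y ::ᵥ List.Vector.ofFn fun i => ρ (xs i.succ))) →
      ∀ t i ρ', (wh s body).rel (st ρ t i (R i)) ρ' ↔ ρ' = st ρ 0 (i + t) (R (i + t)) := by
    intro ρ h0 hz0 R hR t
    induction t with
    | zero =>
      intro i ρ'
      rw [wh_zero (by simp [st])]; simp
    | succ t ih =>
      intro i ρ'
      rw [wh_succ (k := t) (by simp [st])]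
      have e1 : update (st ρ (t + 1) i (R i)) s t = st ρ t i (R i) := by
        funext x; simp only [st, update_apply]; split_ifs <;> first | rfl | omega
      rw [e1]
      have hb : ∀ σ, body.rel (st ρ t i (R i)) σ ↔ σ = st ρ t (i + 1) (R (i + 1)) := by
        intro σ
        have h1 := hPg (st ρ t i (R i)) (fun j hj => by
          simp only [st, update_apply]
          have := h0 j (by omega)
          split_ifs <;> omega) (by
          simp only [st, update_apply]
          have := h0 (s + 2) (by omega)
          split_ifs <;> omega)
        have h2 : (List.Vector.ofFn fun k => st ρ t i (R i)
            ((Fin.cons (s + 1) (Fin.cons z fun i => xs i.succ) : Fin (n + 2) → ℕ) k)) =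
            (i ::ᵥ R i ::ᵥ List.Vector.ofFn fun i => ρ (xs i.succ)) := by
          apply List.Vector.ext
          intro k
          refine Fin.cases ?_ (fun k => Fin.cases ?_ (fun k => ?_) k) k
          · simp [st]
          · simp only [List.Vector.get_ofFn, Fin.cons_succ, Fin.cons_zero,
              List.Vector.get_cons_succ, List.Vector.get_cons_zero]
            simp only [st, update_apply]
            split_ifs <;> first | rfl | omega
          · have h3 := hs k.succ
            have h4 := hx k.succ
            simp only [List.Vector.get_ofFn, Fin.cons_succ,
              List.Vector.get_cons_succ]
            simp only [st, update_apply]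
            split_ifs <;> first | rfl | omega
        rw [h2, ← hR] at h1
        rw [seq_det h1, seq_det clr_rel, seq_det (mv_rel (by omega))]
        simp only [RProg.rel, RInstr.rel]
        apply Eq.congr_right
        have h5 := h0 (s + 2) (by omega)
        funext x; simp only [st, update_apply]
        split_ifs <;> first | rfl | omega | (subst_vars; omega)
      simp only [hb, exists_eq_left]
      rw [ih]
      rw [show i + 1 + t = i + (t + 1) by omega]
  refine ⟨seq Pf (seq (cp (xs 0) s (s + 1)) (seq (wh s body) (clr (s + 1)))), ?_⟩
  intro ρ h0 hz0 ρ'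
  rw [seq_det (hPf ρ (fun j hj => h0 j (by omega)) hz0)]
  rw [seq_det (cp_rel (hs 0).ne (by have := hs 0; omega) (by omega) (by
    have := h0 (s + 1) (by omega)
    simp only [update_apply]; split_ifs <;> omega))]
  let R : ℕ → ℕ := fun y => y.rec (f (List.Vector.ofFn fun i => ρ (xs i.succ))) fun y IH =>
    g (y ::ᵥ IH ::ᵥ List.Vector.ofFn fun i => ρ (xs i.succ))
  have hl := hloop ρ h0 hz0 R (fun y => rfl) (ρ (xs 0)) 0
  have e : update (update ρ z (f (List.Vector.ofFn fun i => ρ (xs i.succ)))) s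
      (update ρ z (f (List.Vector.ofFn fun i => ρ (xs i.succ))) s +
        update ρ z (f (List.Vector.ofFn fun i => ρ (xs i.succ))) (xs 0)) =
      st ρ (ρ (xs 0)) 0 (R 0) := by
    have h1 := h0 s le_rfl
    have h2 := h0 (s + 1) (by omega)
    have h3 := hx 0
    have h4 := hs 0
    funext x; simp only [st, update_apply, R]
    split_ifs <;> first | rfl | omega | (subst_vars; omega)
  rw [e, seq_det hl, clr_rel]
  apply Eq.congr_right
  have h1 := h0 s le_rfl
  have h2 := h0 (s + 1) (by omega)
  funext x; simp only [st, update_apply, R]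
  simp only [List.Vector.ofFn, List.Vector.head_cons, List.Vector.tail_cons, Nat.zero_add]
  split_ifs <;> first | rfl | omega | (subst_vars; omega)

theorem rcomp_comp {m n} {f : List.Vector ℕ n → ℕ} (g : Fin n → List.Vector ℕ m → ℕ)
    (hf : RComp f) (hg : ∀ i, RComp (g i)) :
    RComp fun a => f (List.Vector.ofFn fun i => g i a) := by
  intro xs z s hs hz hx
  have hG : ∀ k, k ≤ n → ∃ P : RProg, ∀ ρ : ℕ → ℕ, (∀ j, s ≤ j → ρ j = 0) →
      ∀ ρ', P.rel ρ ρ' ↔ ρ' = fun x => if h : s ≤ x ∧ x < s + k ∧ x - s < n then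
        g ⟨x - s, h.2.2⟩ (List.Vector.ofFn fun i => ρ (xs i)) else ρ x := by
    intro k
    induction k with
    | zero =>
      intro _
      refine ⟨atom skip, fun ρ h0 ρ' => ?_⟩
      simp only [RProg.rel, RInstr.rel]
      apply Eq.congr_right
      funext x
      rw [dif_neg (by omega)]
    | succ k ih =>
      intro hk
      obtain ⟨P, hP⟩ := ih (by omega)
      obtain ⟨P', hP'⟩ := hg ⟨k, hk⟩ xs (s + k) (s + k + 1) (fun i => by have := hs i; omega)
        (by omega) (fun i => by have := hs i; omega)
      refine ⟨seq P P', fun ρ h0 ρ' => ?_⟩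
      rw [seq_det (hP ρ h0)]
      rw [hP']
      · apply Eq.congr_right
        have : (fun i => (if h : s ≤ xs i ∧ xs i < s + k ∧ xs i - s < n then
          g ⟨xs i - s, h.2.2⟩ (List.Vector.ofFn fun i => ρ (xs i)) else ρ (xs i))) =
            fun i => ρ (xs i) := by
          funext i
          rw [dif_neg (by have := hs i; omega)]
        rw [this]
        funext x
        simp only [update_apply]
        by_cases hxk : x = s + k
        · subst hxk
          rw [if_pos rfl, dif_pos (by omega)]
          congr 1
          simp
        · rw [if_neg hxk]
          by_cases h : s ≤ x ∧ x < s + k ∧ x - s < n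
          · rw [dif_pos h, dif_pos (by omega)]
          · rw [dif_neg h, dif_neg (by omega)]
      · intro j hj
        rw [dif_neg (by omega), h0 j (by omega)]
      · rw [dif_neg (by omega), h0 _ (by omega)]
  have hC : ∀ k, ∃ P : RProg, ∀ ρ : ℕ → ℕ,
      ∀ ρ', P.rel ρ ρ' ↔ ρ' = fun x => if s ≤ x ∧ x < s + k then 0 else ρ x := by
    intro k
    induction k with
    | zero =>
      refine ⟨atom skip, fun ρ ρ' => ?_⟩
      simp only [RProg.rel, RInstr.rel]
      apply Eq.congr_right
      funext x
      rw [if_neg (by omega)]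
    | succ k ih =>
      obtain ⟨P, hP⟩ := ih
      refine ⟨seq P (clr (s + k)), fun ρ ρ' => ?_⟩
      rw [seq_det (hP ρ), clr_rel]
      apply Eq.congr_right
      funext x
      simp only [update_apply]
      split_ifs <;> first | rfl | omega
  obtain ⟨PG, hPG⟩ := hG n le_rfl
  obtain ⟨PC, hPC⟩ := hC n
  obtain ⟨PF, hPF⟩ := hf (fun i => s + i) z (s + n) (fun i => by have := i.2; omega) (by omega)
    (fun i => by omega)
  refine ⟨seq PG (seq PF PC), fun ρ h0 hz0 ρ' => ?_⟩
  rw [seq_det (hPG ρ h0)]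
  rw [seq_det (hPF _ (fun j hj => by rw [dif_neg (by omega), h0 j (by omega)])
    (by rw [dif_neg (by omega), hz0]))]
  rw [hPC]
  apply Eq.congr_right
  have : (fun i : Fin n => (if h : s ≤ s + (i : ℕ) ∧ s + (i : ℕ) < s + n ∧ s + (i : ℕ) - s < n then
      g ⟨s + i - s, h.2.2⟩ (List.Vector.ofFn fun i => ρ (xs i)) else ρ (s + i))) =
      fun i => g i (List.Vector.ofFn fun i => ρ (xs i)) := by
    funext i
    have := i.2
    rw [dif_pos (by omega)]
    congr 1
    simp
  rw [this]
  funext x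
  simp only [update_apply]
  by_cases hxz : x = z
  · rw [if_neg (by omega), if_pos hxz, if_pos hxz]
  · rw [if_neg hxz, if_neg hxz]
    by_cases h : s ≤ x ∧ x < s + n
    · rw [if_pos h, h0 x h.1]
    · rw [if_neg h, dif_neg (by omega)]

theorem rcomp_of_primrec {n} {f : List.Vector ℕ n → ℕ} (hf : Nat.Primrec' f) : RComp f := by
  induction hf with
  | zero => exact rcomp_zero
  | succ => exact rcomp_succ
  | get i => exact rcomp_get i
  | comp g _ _ h1 h2 => exact rcomp_comp g h1 h2
  | prec _ _ h1 h2 => exact rcomp_prec h1 h2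

/-! ### The search program -/

/-- Program with undecidable halting: starting with input `x` in register 0. -/
theorem exists_prog (F : List.Vector ℕ 2 → ℕ) (hF : Nat.Primrec' F) :
    ∃ P : RProg, ∀ x : ℕ, (∃ ρ', P.rel (update (fun _ => 0) 0 x) ρ') ↔
      ∃ k, F (k ::ᵥ x ::ᵥ List.Vector.nil) = 0 := by
  obtain ⟨P, hP⟩ := rcomp_of_primrec hF (Fin.cons 1 (Fin.cons 0 Fin.elim0)) 2 3
    (by decide) (by decide) (by decide)
  let st : ℕ → ℕ → ℕ → ℕ → ℕ := fun x k t =>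
    update (update (update (fun _ => 0) 0 x) 1 k) 2 t
  have h1 : ∀ x k ρ', P.rel (st x k 0) ρ' ↔ ρ' = st x k (F (k ::ᵥ x ::ᵥ List.Vector.nil)) := by
    intro x k ρ'
    rw [hP _ (fun j hj => by simp only [st, update_apply]; split_ifs <;> first | rfl | omega)
      (by simp [st])]
    apply Eq.congr_right
    have : (List.Vector.ofFn fun i => st x k 0
        ((Fin.cons 1 (Fin.cons 0 Fin.elim0) : Fin 2 → ℕ) i)) = k ::ᵥ x ::ᵥ List.Vector.nil := by
      apply List.Vector.ext
      intro i
      fin_cases i <;> simp [st, List.Vector.ofFn, List.Vector.get, Fin.cons]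
    rw [this]
    simp [st]
  have hst0 : ∀ x, update (fun _ => 0) 0 x = st x 0 0 := by
    intro x
    funext j; simp only [st, update_apply]; split_ifs <;> first | rfl | omega
  let body : RProg := seq (clr 2) (seq (atom (inc 1)) P)
  have hb : ∀ x k t ρ', body.rel (st x k t) ρ' ↔
      ρ' = st x (k + 1) (F ((k + 1) ::ᵥ x ::ᵥ List.Vector.nil)) := by
    intro x k t ρ'
    rw [seq_det clr_rel, seq_det (ρ₁ := st x (k + 1) 0), h1]
    intro σ
    simp only [RProg.rel, RInstr.rel]
    apply Eq.congr_right
    funext j; simp only [st, update_apply]; split_ifs <;> first | rfl | omega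
  refine ⟨seq P (wh 2 body), fun x => ?_⟩
  simp only [hst0, seq_det (h1 x 0)]
  have hdec : ∀ k t t', update (st x k t) 2 t' = st x k t' := by
    intro k t t'; simp [st]
  constructor
  · rintro ⟨ρ', ρ₁, hs, h2, rfl⟩
    have : ∀ ρ₁, Relation.ReflTransGen (seq (atom (dec 2)) body).rel
        (st x 0 (F (0 ::ᵥ x ::ᵥ List.Vector.nil))) ρ₁ →
        ∃ k, ρ₁ = st x k (F (k ::ᵥ x ::ᵥ List.Vector.nil)) := by
      intro ρ₁ h
      induction h with
      | refl => exact ⟨0, rfl⟩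
      | tail _ h ih =>
        obtain ⟨k, rfl⟩ := ih
        obtain ⟨σ, ⟨_, rfl⟩, h⟩ := h
        rw [hdec, hb] at h
        exact ⟨_, h⟩
    obtain ⟨k, rfl⟩ := this _ hs
    exact ⟨k, by simpa [st] using h2⟩
  · rintro ⟨k, hk⟩
    have : ∀ j i, i + j = k → ∃ ρ', (wh 2 body).rel
        (st x i (F (i ::ᵥ x ::ᵥ List.Vector.nil))) ρ' := by
      intro j
      induction j with
      | zero =>
        intro i hi
        obtain rfl : i = k := by omega
        exact ⟨_, (wh_zero (by simp [st, hk])).2 rfl⟩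
      | succ j ih =>
        intro i hi
        rcases Nat.eq_zero_or_eq_succ_pred (F (i ::ᵥ x ::ᵥ List.Vector.nil)) with h | h
        · exact ⟨_, (wh_zero (by simp [st, h])).2 rfl⟩
        · obtain ⟨ρ', h'⟩ := ih (i + 1) (by omega)
          refine ⟨ρ', (wh_succ (by simp only [st, update_self]; exact h)).2 ⟨_, ?_, h'⟩⟩
          rw [hdec, hb]
    exact this k 0 (by omega)

/-! ### Compilation to machines with states -/

/-- one step of a state machine with labelled edges -/
def MStep {Q : Type} (E : List (Q × RInstr × Q)) (c c' : Q × (ℕ → ℕ)) : Prop :=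
  ∃ i, (c.1, i, c'.1) ∈ E ∧ i.rel c.2 c'.2

def pedges : RProg → List RProg → List (List RProg × RInstr × List RProg)
  | atom i, K => [(atom i :: K, i, K)]
  | seq P Q, K => (seq P Q :: K, skip, P :: Q :: K) :: (pedges P (Q :: K) ++ pedges Q K)
  | RProg.star P, K => (star P :: K, skip, K) :: (star P :: K, skip, P :: star P :: K) ::
      pedges P (star P :: K)

/-- Semantics of continuations -/
def relL : List RProg → (ℕ → ℕ) → (ℕ → ℕ) → Prop
  | [], ρ, ρ' => ρ' = ρ
  | P :: K, ρ, ρ' => ∃ ρ₁, P.rel ρ ρ₁ ∧ relL K ρ₁ ρ'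

theorem pedges_sound {P K q i q'} (h : (q, i, q') ∈ pedges P K) {ρ ρ₁ ρ' : ℕ → ℕ}
    (hi : i.rel ρ ρ₁) (hr : relL q' ρ₁ ρ') : relL q ρ ρ' := by
  induction P generalizing K with
  | atom j =>
    simp only [pedges, List.mem_singleton, Prod.mk.injEq] at h
    obtain ⟨rfl, rfl, rfl⟩ := h
    exact ⟨ρ₁, hi, hr⟩
  | seq P Q ih1 ih2 =>
    simp only [pedges, List.mem_cons, List.mem_append, Prod.mk.injEq] at h
    rcases h with ⟨rfl, rfl, rfl⟩ | h | h
    · obtain rfl : ρ₁ = ρ := hi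
      obtain ⟨ρ₂, h2, ρ₃, h3, h4⟩ := hr
      exact ⟨ρ₃, ⟨ρ₂, h2, h3⟩, h4⟩
    · exact ih1 h
    · exact ih2 h
  | star P ih =>
    simp only [pedges, List.mem_cons, Prod.mk.injEq] at h
    rcases h with ⟨rfl, rfl, rfl⟩ | ⟨rfl, rfl, rfl⟩ | h
    · obtain rfl : ρ₁ = ρ := hi
      exact ⟨_, Relation.ReflTransGen.refl, hr⟩
    · obtain rfl : ρ₁ = ρ := hi
      obtain ⟨ρ₂, h2, ρ₃, h3, h4⟩ := hr
      exact ⟨ρ₃, Relation.ReflTransGen.head h2 h3, h4⟩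
    · exact ih h

theorem MStep.reach_mono {Q : Type} {E E' : List (Q × RInstr × Q)} (h : E ⊆ E') {c c'}
    (hc : Relation.ReflTransGen (MStep E) c c') : Relation.ReflTransGen (MStep E') c c' :=
  Relation.ReflTransGen.mono
    (show MStep E ≤ MStep E' from fun _ _ ⟨i, h1, h2⟩ => ⟨i, h h1, h2⟩) _ _ hc

theorem pedges_complete {P K} {ρ ρ' : ℕ → ℕ} (h : P.rel ρ ρ') :
    Relation.ReflTransGen (MStep (pedges P K)) (P :: K, ρ) (K, ρ') := by
  induction P generalizing K ρ ρ' with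
  | atom j => exact Relation.ReflTransGen.single ⟨j, by simp [pedges], h⟩
  | seq P Q ih1 ih2 =>
    obtain ⟨ρ₁, h1, h2⟩ := h
    refine Relation.ReflTransGen.head (b := (P :: Q :: K, ρ)) ⟨skip, by simp [pedges], rfl⟩ ?_
    refine Relation.ReflTransGen.trans (b := (Q :: K, ρ₁)) ?_ ?_
    · exact MStep.reach_mono (by intro x hx; simp [pedges, hx]) (ih1 h1)
    · exact MStep.reach_mono (by intro x hx; simp [pedges, hx]) (ih2 h2)
  | star P ih =>
    have h' : Relation.ReflTransGen P.rel ρ ρ' := h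
    clear h
    induction h' using Relation.ReflTransGen.head_induction_on with
    | refl => exact Relation.ReflTransGen.single ⟨skip, by simp [pedges], rfl⟩
    | head h1 _ ih' =>
      refine Relation.ReflTransGen.head (b := (P :: star P :: K, _))
        ⟨skip, by simp [pedges], rfl⟩ ?_
      refine Relation.ReflTransGen.trans ?_ ih'
      exact MStep.reach_mono (by intro x hx; simp [pedges, hx]) (ih h1)

theorem pedges_reach {P : RProg} {ρ ρ' : ℕ → ℕ} :
    Relation.ReflTransGen (MStep (pedges P [])) ([P], ρ) ([], ρ') ↔ P.rel ρ ρ' := by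
  constructor
  · intro h
    have : ∀ c c', Relation.ReflTransGen (MStep (pedges P [])) c c' →
        c'.1 = [] → relL c.1 c.2 c'.2 := by
      intro c c' h hc
      induction h using Relation.ReflTransGen.head_induction_on with
      | refl => rw [hc]; rfl
      | head h _ ih =>
        obtain ⟨i, h1, h2⟩ := h
        exact pedges_sound h1 h2 ih
    obtain ⟨ρ₁, h1, h2⟩ := this _ _ h rfl
    obtain rfl : ρ' = ρ₁ := h2
    exact h1
  · exact pedges_complete

/-! ### Goedel numbering: affine systems -/

/-- Edges `(q, p, r, p', r', q')`: from state `q` with value `p k + r` to `q'`, `p' k + r'`. -/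
abbrev AEdge (Q : Type) := Q × ℕ × ℕ × ℕ × ℕ × Q

/-- One step of an affine system. -/
def AStep {Q : Type} (E : List (AEdge Q)) (c c' : Q × ℕ) : Prop :=
  ∃ p r p' r' k, (c.1, p, r, p', r', c'.1) ∈ E ∧ c.2 = p * k + r ∧ c'.2 = p' * k + r'

noncomputable def pr (i : ℕ) : ℕ := Nat.nth Nat.Prime i

theorem pr_prime (i : ℕ) : (pr i).Prime := Nat.prime_nth_prime i

theorem pr_inj {i j : ℕ} (h : pr i = pr j) : i = j :=
  Nat.nth_injective Nat.infinite_setOfPred_prime h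

/-- Goedel number of the first `B` registers. -/
noncomputable def enc (B : ℕ) (ρ : ℕ → ℕ) : ℕ := ∏ i ∈ Finset.range B, pr i ^ ρ i

theorem enc_eq {B i : ℕ} (hi : i < B) (ρ : ℕ → ℕ) :
    enc B ρ = pr i ^ ρ i * ∏ j ∈ (Finset.range B).erase i, pr j ^ ρ j :=
  (Finset.mul_prod_erase _ _ (Finset.mem_range.2 hi)).symm

theorem enc_update {B i : ℕ} (hi : i < B) (ρ : ℕ → ℕ) (v : ℕ) :
    enc B (update ρ i v) = pr i ^ v * ∏ j ∈ (Finset.range B).erase i, pr j ^ ρ j := by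
  rw [enc_eq hi, update_self]
  congr 1
  apply Finset.prod_congr rfl
  intro j hj
  rw [update_of_ne (Finset.ne_of_mem_erase hj)]

theorem pr_dvd_enc {B i : ℕ} (hi : i < B) (ρ : ℕ → ℕ) : pr i ∣ enc B ρ ↔ ρ i ≠ 0 := by
  rw [enc_eq hi]
  constructor
  · intro h h0
    rw [h0, pow_zero, one_mul, Prime.dvd_finsetProd_iff (pr_prime i).prime] at h
    obtain ⟨j, hj, h⟩ := h
    have := (Nat.prime_dvd_prime_iff_eq (pr_prime i) (pr_prime j)).1
      ((pr_prime i).dvd_of_dvd_pow h)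
    exact Finset.ne_of_mem_erase hj (pr_inj this).symm
  · intro h
    exact Dvd.dvd.mul_right (dvd_pow_self _ h) _

/-- Translation of a machine edge into affine edges. -/
noncomputable def aedges {Q : Type} : Q × RInstr × Q → List (AEdge Q)
  | (q, skip, q') => [(q, 1, 0, 1, 0, q')]
  | (q, inc i, q') => [(q, 1, 0, pr i, 0, q')]
  | (q, dec i, q') => [(q, pr i, 0, 1, 0, q')]
  | (q, tz i, q') => (List.range (pr i - 1)).map fun j => (q, pr i, j + 1, pr i, j + 1, q')

def RInstr.below (B : ℕ) : RInstr → Prop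
  | skip => True
  | inc i => i < B
  | dec i => i < B
  | tz i => i < B

theorem RInstr.exists_below (i : RInstr) : ∃ B, ∀ B', B ≤ B' → i.below B' := by
  cases i with
  | skip => exact ⟨0, fun _ _ => trivial⟩
  | inc i => exact ⟨i + 1, fun _ h => h⟩
  | dec i => exact ⟨i + 1, fun _ h => h⟩
  | tz i => exact ⟨i + 1, fun _ h => h⟩

theorem exists_below_list {Q : Type} (E : List (Q × RInstr × Q)) :
    ∃ B, 0 < B ∧ ∀ e ∈ E, e.2.1.below B := by
  choose f hf using RInstr.exists_below
  refine ⟨(E.map fun e => f e.2.1).sum + 1, by omega, fun e he => hf _ _ ?_⟩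
  have := List.single_le_sum (l := E.map fun e => f e.2.1) (by simp) (f e.2.1)
    (List.mem_map.2 ⟨e, he, rfl⟩)
  omega

theorem aedges_complete {Q : Type} {B : ℕ} {q q' : Q} {i : RInstr} (hB : i.below B)
    {ρ ρ' : ℕ → ℕ} (h : i.rel ρ ρ') : AStep (aedges (q, i, q')) (q, enc B ρ) (q', enc B ρ') := by
  cases i with
  | skip =>
    obtain rfl : ρ' = ρ := h
    exact ⟨1, 0, 1, 0, enc B ρ', by simp [aedges], by simp, by simp⟩
  | inc i =>
    obtain rfl : ρ' = _ := h
    refine ⟨1, 0, pr i, 0, enc B ρ, by simp [aedges], by simp, ?_⟩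
    simp only [enc_update hB, enc_eq hB]
    ring
  | dec i =>
    obtain ⟨h0, rfl⟩ := h
    refine ⟨pr i, 0, 1, 0, enc B (update ρ i (ρ i - 1)), by simp [aedges], ?_, by simp⟩
    obtain ⟨k, hk⟩ := Nat.exists_eq_succ_of_ne_zero h0
    simp only [enc_update hB, enc_eq hB, hk]
    simp
    ring
  | tz i =>
    obtain ⟨h0, rfl⟩ := h
    have h1 : ¬ pr i ∣ enc B ρ' := by rw [pr_dvd_enc hB]; simpa using h0
    have h2 := (pr_prime i).pos
    have h3 := Nat.mod_lt (enc B ρ') h2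
    have h4 : enc B ρ' % pr i ≠ 0 := fun h => h1 (Nat.dvd_of_mod_eq_zero h)
    have h5 := Nat.div_add_mod (enc B ρ') (pr i)
    refine ⟨pr i, enc B ρ' % pr i, pr i, enc B ρ' % pr i, enc B ρ' / pr i, ?_, h5.symm, h5.symm⟩
    simp only [aedges, List.mem_map, List.mem_range]
    refine ⟨enc B ρ' % pr i - 1, by omega, ?_⟩
    rw [Nat.sub_add_cancel (by omega)]

theorem aedges_sound {Q : Type} {B : ℕ} {q q' : Q} {i : RInstr} (hB : i.below B)
    {ρ : ℕ → ℕ} {c c' : Q × ℕ} (h : AStep (aedges (q, i, q')) c c') (hc : c.2 = enc B ρ) :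
    c.1 = q ∧ c'.1 = q' ∧ ∃ ρ', i.rel ρ ρ' ∧ c'.2 = enc B ρ' := by
  obtain ⟨p, r, p', r', k, hm, h1, h2⟩ := h
  rw [hc] at h1
  cases i with
  | skip =>
    simp only [aedges, List.mem_singleton, Prod.mk.injEq] at hm
    obtain ⟨e1, rfl, rfl, rfl, rfl, e2⟩ := hm
    refine ⟨e1, e2, ρ, rfl, ?_⟩
    rw [h1, h2]
  | inc i =>
    simp only [aedges, List.mem_singleton, Prod.mk.injEq] at hm
    obtain ⟨e1, rfl, rfl, rfl, rfl, e2⟩ := hm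
    refine ⟨e1, e2, _, rfl, ?_⟩
    rw [h2, enc_update hB]
    simp only [one_mul, add_zero] at h1
    rw [← h1, enc_eq hB]
    ring
  | dec i =>
    simp only [aedges, List.mem_singleton, Prod.mk.injEq] at hm
    obtain ⟨e1, rfl, rfl, rfl, rfl, e2⟩ := hm
    have h0 : ρ i ≠ 0 := (pr_dvd_enc hB ρ).1 ⟨k, by simpa using h1⟩
    refine ⟨e1, e2, _, ⟨h0, rfl⟩, ?_⟩
    rw [h2, enc_update hB]
    obtain ⟨j, hj⟩ := Nat.exists_eq_succ_of_ne_zero h0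
    rw [enc_eq hB, hj, pow_succ] at h1
    rw [hj]
    simp only [add_zero, one_mul, Nat.succ_sub_one]
    apply Nat.eq_of_mul_eq_mul_left (pr_prime i).pos
    rw [add_zero] at h1
    rw [← h1]
    ring
  | tz i =>
    simp only [aedges, List.mem_map, List.mem_range, Prod.mk.injEq] at hm
    obtain ⟨j, hj, e1, rfl, rfl, rfl, rfl, e2⟩ := hm
    refine ⟨e1.symm, e2.symm, ρ, ⟨?_, rfl⟩, by rw [h1, h2]⟩
    by_contra h0
    have := (pr_dvd_enc hB ρ).2 h0
    rw [h1, Nat.dvd_add_right (dvd_mul_right _ _)] at this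
    have := Nat.le_of_dvd (by omega) this
    omega

/-- The affine system of a machine; the final state may decrease the value. -/
noncomputable def asys {Q : Type} (E : List (Q × RInstr × Q)) (qf : Q) : List (AEdge Q) :=
  (qf, 1, 1, 1, 0, qf) :: E.flatMap aedges

theorem asys_reach {Q : Type} {E : List (Q × RInstr × Q)} {q₀ qf : Q} {B : ℕ}
    (hB : ∀ e ∈ E, e.2.1.below B) (ρ : ℕ → ℕ) :
    Relation.ReflTransGen (AStep (asys E qf)) (q₀, enc B ρ) (qf, 0) ↔
      ∃ ρ', Relation.ReflTransGen (MStep E) (q₀, ρ) (qf, ρ') := by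
  constructor
  · intro h
    have : ∀ c, Relation.ReflTransGen (AStep (asys E qf)) (q₀, enc B ρ) c →
        (∃ ρ', c.2 = enc B ρ' ∧ Relation.ReflTransGen (MStep E) (q₀, ρ) (c.1, ρ')) ∨
        (∃ ρ', Relation.ReflTransGen (MStep E) (q₀, ρ) (qf, ρ')) := by
      intro c h
      induction h with
      | refl => exact Or.inl ⟨ρ, rfl, Relation.ReflTransGen.refl⟩
      | @tail c c' _ h ih =>
        rcases ih with ⟨ρ', h1, h2⟩ | ih
        · obtain ⟨p, r, p', r', k, hm, h3, h4⟩ := h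
          simp only [asys, List.mem_cons, List.mem_flatMap] at hm
          rcases hm with hm | ⟨e, he, hm⟩
          · simp only [Prod.mk.injEq] at hm
            right
            rw [hm.1] at h2
            exact ⟨_, h2⟩
          · left
            obtain ⟨q, i, q'⟩ := e
            obtain ⟨e1, e2, σ, h5, h6⟩ := aedges_sound (hB _ he)
              (c := c) (c' := c') ⟨p, r, p', r', k, hm, h3, h4⟩ h1
            exact ⟨σ, h6, h2.tail ⟨i, by rw [e1, e2]; exact he, h5⟩⟩
        · exact Or.inr ih
    rcases this _ h with ⟨ρ', _, h⟩ | h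
    · exact ⟨ρ', h⟩
    · exact h
  · rintro ⟨ρ', h⟩
    have h1 : ∀ c, Relation.ReflTransGen (MStep E) (q₀, ρ) c →
        Relation.ReflTransGen (AStep (asys E qf)) (q₀, enc B ρ) (c.1, enc B c.2) := by
      intro c h
      induction h with
      | refl => exact Relation.ReflTransGen.refl
      | tail _ h ih =>
        refine ih.tail ?_
        obtain ⟨i, h2, h3⟩ := h
        obtain ⟨p, r, p', r', k, hm, h4⟩ := aedges_complete (hB _ h2) h3
        refine ⟨p, r, p', r', k, ?_, h4⟩
        simp only [asys, List.mem_cons, List.mem_flatMap]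
        exact Or.inr ⟨_, h2, hm⟩
    refine (h1 _ h).trans ?_
    have h2 : ∀ n, Relation.ReflTransGen (AStep (asys E qf)) (qf, n) (qf, 0) := by
      intro n
      induction n with
      | zero => exact Relation.ReflTransGen.refl
      | succ n ih =>
        exact Relation.ReflTransGen.head (b := (qf, n))
          ⟨1, 1, 1, 0, n, by simp [asys], by simp, by simp⟩ ih
    exact h2 _

open Nat.Partrec in
/-- An affine system with undecidable reachability problem. -/
theorem exists_affine : ∃ (Q : Type) (_ : Encodable Q) (E : List (AEdge Q)) (q₀ qf : Q)
    (f : Code → ℕ), Computable f ∧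
      ∀ c, Relation.ReflTransGen (AStep E) (q₀, f c) (qf, 0) ↔ (Code.eval c 0).Dom := by
  let F : List.Vector ℕ 2 → ℕ := fun v =>
    if (Code.evaln v.head (Denumerable.ofNat Code v.tail.head) 0).isSome then 0 else 1
  have hF : Nat.Primrec' F := by
    apply Nat.Primrec'.of_prim
    have h1 : Primrec fun v : List.Vector ℕ 2 =>
        Code.evaln v.head (Denumerable.ofNat Code v.tail.head) 0 := by
      refine Code.primrec_evaln.comp (Primrec.pair (Primrec.pair Primrec.vector_head ?_)
        (Primrec.const 0))
      exact (Primrec.ofNat Code).comp (Primrec.vector_head.comp Primrec.vector_tail)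
    exact Primrec.ite (Primrec.eq.comp (Primrec.option_isSome.comp h1) (Primrec.const true))
      (Primrec.const 0) (Primrec.const 1)
  obtain ⟨P, hP⟩ := exists_prog F hF
  obtain ⟨B, hB0, hB⟩ := exists_below_list (pedges P [])
  refine ⟨List RProg, inferInstance, asys (pedges P []) [], [P], [],
    fun c => 2 ^ Encodable.encode c, ?_, fun c => ?_⟩
  · have : Primrec (fun n : ℕ => 2 ^ n) := by
      have h := Primrec.nat_rec₁ (f := fun _ x => 2 * x) 1
        (Primrec.nat_mul.comp (Primrec.const 2) Primrec.snd)
      refine h.of_eq fun n => ?_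
      induction n with
      | zero => rfl
      | succ n ih => rw [pow_succ, ← ih, mul_comm]
    exact (this.comp Primrec.encode).to_comp
  · have h2 : 2 ^ Encodable.encode c = enc B (update (fun _ => 0) 0 (Encodable.encode c)) := by
      rw [enc_update hB0]
      simp [pr, Nat.nth_prime_zero_eq_two]
    simp only [h2]
    rw [asys_reach hB]
    simp only [pedges_reach]
    rw [hP]
    constructor
    · rintro ⟨k, hk⟩
      simp only [F, List.Vector.head_cons, List.Vector.tail_cons, Denumerable.ofNat_encode] at hk
      have : (Code.evaln k c 0).isSome := by by_contra h; simp [h] at hk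
      obtain ⟨x, hx⟩ := Option.isSome_iff_exists.1 this
      exact Part.dom_iff_mem.2 ⟨x, Code.evaln_complete.2 ⟨k, hx⟩⟩
    · intro h
      obtain ⟨x, hx⟩ := Part.dom_iff_mem.1 h
      obtain ⟨k, hk⟩ := Code.evaln_complete.1 hx
      refine ⟨k, ?_⟩
      simp only [F, List.Vector.head_cons, List.Vector.tail_cons, Denumerable.ofNat_encode]
      rw [if_pos]
      exact Option.isSome_iff_exists.2 ⟨x, hk⟩

/-! ### A permutation representation of the group -/

/-- The group -/
abbrev GP := RAAG (SimpleGraph.pathGraph 4)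

/-- Generators -/
def gA : GP := PresentedGroup.of 0
/-- Generators -/
def gB : GP := PresentedGroup.of 1
/-- Generators -/
def gC : GP := PresentedGroup.of 2
/-- Generators -/
def gD : GP := PresentedGroup.of 3

theorem gp_comm {u v : Fin 4} (h : (SimpleGraph.pathGraph 4).Adj u v) :
    Commute (PresentedGroup.of u : GP) (PresentedGroup.of v) := by
  have : PresentedGroup.mk (raagRels (SimpleGraph.pathGraph 4)) (FreeGroup.of u * FreeGroup.of v *
      (FreeGroup.of u)⁻¹ * (FreeGroup.of v)⁻¹) = 1 :=
    PresentedGroup.one_of_mem ⟨u, v, h, rfl⟩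
  simp only [map_mul, map_inv] at this
  have h2 := mul_inv_eq_one.1 this
  exact mul_inv_eq_iff_eq_mul.1 h2

theorem comm_AB : Commute gA gB := gp_comm (by rw [SimpleGraph.pathGraph_adj]; decide)
theorem comm_BC : Commute gB gC := gp_comm (by rw [SimpleGraph.pathGraph_adj]; decide)
theorem comm_CD : Commute gC gD := gp_comm (by rw [SimpleGraph.pathGraph_adj]; decide)

/-- Bouquet of lines. -/
inductive Pos | home | pos (q k : ℕ) | neg (q k : ℕ)
  deriving DecidableEq

open Pos

/-- shift along the `q`-th line -/
def up (q : ℕ) : Pos → Pos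
  | home => pos q 0
  | pos p k => if p = q then pos p (k + 1) else pos p k
  | neg p 0 => if p = q then home else neg p 0
  | neg p (k + 1) => if p = q then neg p k else neg p (k + 1)

/-- shift back along the `q`-th line -/
def down (q : ℕ) : Pos → Pos
  | home => neg q 0
  | neg p k => if p = q then neg p (k + 1) else neg p k
  | pos p 0 => if p = q then home else pos p 0
  | pos p (k + 1) => if p = q then pos p k else pos p (k + 1)

/-- shift as a permutation -/
def sh (q : ℕ) : Equiv.Perm Pos where
  toFun := up q
  invFun := down q
  left_inv := by
    rintro (_ | ⟨p, _ | k⟩ | ⟨p, _ | k⟩) <;> simp only [up] <;> (try split_ifs) <;>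
      simp_all [down]
  right_inv := by
    rintro (_ | ⟨p, _ | k⟩ | ⟨p, _ | k⟩) <;> simp only [down] <;> (try split_ifs) <;>
      simp_all [up]

/-- Counters: errors, exponent of `b`, exponent of `c`. -/
abbrev Ctr := ℤ × ℤ × ℤ

/-- action of `b` -/
def hb : Equiv.Perm Ctr where
  toFun h := (h.1, h.2.1 + 1, h.2.2)
  invFun h := (h.1, h.2.1 - 1, h.2.2)
  left_inv h := by simp
  right_inv h := by simp

/-- action of `c` -/
def hc : Equiv.Perm Ctr where
  toFun h := (h.1, h.2.1, h.2.2 + 1)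
  invFun h := (h.1, h.2.1, h.2.2 - 1)
  left_inv h := by simp
  right_inv h := by simp

/-- action of `d` -/
def hd : Equiv.Perm Ctr where
  toFun h := (h.1 + (if h.2.1 = 0 then 0 else 1), h.2.1, h.2.2)
  invFun h := (h.1 - (if h.2.1 = 0 then 0 else 1), h.2.1, h.2.2)
  left_inv h := by simp
  right_inv h := by simp

/-- action of `a⁻¹ c a` -/
def ha : Equiv.Perm Ctr where
  toFun h := (h.1 + (if h.2.2 = 0 then 0 else 1), h.2.1, h.2.2)
  invFun h := (h.1 - (if h.2.2 = 0 then 0 else 1), h.2.1, h.2.2)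
  left_inv h := by simp
  right_inv h := by simp

/-- act at home only -/
def homeP : Equiv.Perm Ctr →* Equiv.Perm (Pos × Ctr) where
  toFun π := Equiv.Perm.prodExtendRight home π
  map_one' := by
    ext1 ⟨p, h⟩
    by_cases hp : p = home
    · subst hp; simp
    · simp [Equiv.Perm.prodExtendRight_apply_ne _ hp]
  map_mul' π σ := by
    ext1 ⟨p, h⟩
    by_cases hp : p = home
    · subst hp; simp
    · simp [Equiv.Perm.prodExtendRight_apply_ne _ hp]

theorem homeP_home (π : Equiv.Perm Ctr) (h : Ctr) : homeP π (home, h) = (home, π h) :=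
  Equiv.Perm.prodExtendRight_apply_eq _ _ _

theorem homeP_ne (π : Equiv.Perm Ctr) {p : Pos} (hp : p ≠ home) (h : Ctr) :
    homeP π (p, h) = (p, h) :=
  Equiv.Perm.prodExtendRight_apply_ne _ hp _

/-- family of permutations acting on copies -/
def famP (f : ℤ → Equiv.Perm (Pos × Ctr)) : Equiv.Perm (ℤ × Pos × Ctr) := Equiv.prodCongrRight f

theorem famP_apply (f) (i : ℤ) (y : Pos × Ctr) : famP f (i, y) = (i, f i y) := rfl

theorem famP_comm {f g} (h : ∀ i, Commute (f i) (g i)) : Commute (famP f) (famP g) := by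
  ext1 ⟨i, y⟩
  simp only [Equiv.Perm.mul_apply, famP_apply]
  rw [← Equiv.Perm.mul_apply, (h i).eq, Equiv.Perm.mul_apply]

/-- representation of `a` -/
def pA : Equiv.Perm (ℤ × Pos × Ctr) := Equiv.prodCongr (Equiv.addRight 1) (Equiv.refl _)

theorem pA_apply (i : ℤ) (y : Pos × Ctr) : pA (i, y) = (i + 1, y) := rfl

/-- representation of `b` -/
def pB : Equiv.Perm (ℤ × Pos × Ctr) := famP fun _ => homeP hb

/-- representation of `c` -/
def pC : Equiv.Perm (ℤ × Pos × Ctr) :=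
  famP fun i => if i = 0 then homeP hc else if i = 1 then homeP ha else 1

/-- representation of `d` -/
def pD : Equiv.Perm (ℤ × Pos × Ctr) :=
  famP fun i => if i = 0 then homeP hd else if 2 ≤ i then
    Equiv.prodCongr (sh (i - 2).toNat) (Equiv.refl _) else 1

theorem pAB : Commute pA pB := by
  ext1 ⟨i, y⟩
  simp [pB, famP_apply, pA_apply]

theorem pBC : Commute pB pC := by
  apply famP_comm
  intro i
  split_ifs
  · apply Commute.map
    ext1 h
    simp [hb, hc]
  · apply Commute.map
    ext1 h
    simp [hb, ha]
  · exact Commute.one_right _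

theorem pCD : Commute pC pD := by
  apply famP_comm
  intro i
  by_cases h0 : i = 0
  · rw [if_pos h0, if_pos h0]
    apply Commute.map
    ext1 h
    simp [hc, hd]
  · by_cases h1 : i = 1
    · subst h1
      simp
    · simp [h0, h1]

/-- images of the generators -/
def pgen : Fin 4 → Equiv.Perm (ℤ × Pos × Ctr) := ![pA, pB, pC, pD]

theorem pgen_rels : ∀ r ∈ raagRels (SimpleGraph.pathGraph 4), FreeGroup.lift pgen r = 1 := by
  rintro r ⟨u, v, h, rfl⟩
  have key : ∀ u v : Fin 4, u.val + 1 = v.val → Commute (pgen u) (pgen v) := by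
    intro u v h
    fin_cases u <;> fin_cases v <;> simp at h
    · exact pAB
    · exact pBC
    · exact pCD
  have : Commute (pgen u) (pgen v) := by
    rcases SimpleGraph.pathGraph_adj.1 h with h | h
    · exact key u v h
    · exact (key v u h).symm
  simp only [map_mul, map_inv, FreeGroup.lift_apply_of]
  rw [this.eq]
  group

/-- The representation -/
def rep : GP →* Equiv.Perm (ℤ × Pos × Ctr) := PresentedGroup.toGroup pgen_rels

theorem rep_A : rep gA = pA := PresentedGroup.toGroup.of _
theorem rep_B : rep gB = pB := PresentedGroup.toGroup.of _
theorem rep_C : rep gC = pC := PresentedGroup.toGroup.of _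
theorem rep_D : rep gD = pD := PresentedGroup.toGroup.of _

theorem rep_A_pow (k : ℕ) (i : ℤ) (y : Pos × Ctr) : rep (gA ^ k) (i, y) = (i + k, y) := by
  induction k generalizing i with
  | zero => simp
  | succ k ih =>
    rw [pow_succ, map_mul, Equiv.Perm.mul_apply, rep_A, pA_apply, ih]
    simp; ring

theorem rep_A_pow_inv (k : ℕ) (y : Pos × Ctr) : rep (gA ^ k)⁻¹ ((k : ℤ), y) = (0, y) := by
  rw [map_inv, Equiv.Perm.inv_eq_iff_eq, rep_A_pow]
  simp

/-- the free letters -/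
def gU (q : ℕ) : GP := (gA ^ (q + 2))⁻¹ * gD * gA ^ (q + 2)

theorem rep_U (q : ℕ) (p : Pos) (h : Ctr) : rep (gU q) (0, p, h) = (0, up q p, h) := by
  rw [gU, map_mul, map_mul, Equiv.Perm.mul_apply, Equiv.Perm.mul_apply, rep_A_pow, rep_D]
  have : pD (0 + ((q + 2 : ℕ) : ℤ), p, h) = (((q + 2 : ℕ) : ℤ), up q p, h) := by
    rw [zero_add, pD, famP_apply, if_neg (by omega), if_pos (by omega)]
    have : (((q + 2 : ℕ) : ℤ) - 2).toNat = q := by omega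
    rw [this]
    rfl
  rw [this, rep_A_pow_inv]

theorem rep_U_inv (q : ℕ) (p : Pos) (h : Ctr) : rep (gU q)⁻¹ (0, p, h) = (0, down q p, h) := by
  rw [map_inv, Equiv.Perm.inv_eq_iff_eq, rep_U]
  have : up q (down q p) = p := (sh q).right_inv p
  rw [this]

/-- The test letter for `c`. -/
def gT : GP := gA⁻¹ * gC * gA

theorem comm_BT : Commute gB gT :=
  ((comm_AB.symm.inv_right).mul_right comm_BC).mul_right comm_AB.symm

/-- `g` acts on the zeroth copy through the counters at home -/
def Rep (g : GP) (π : Equiv.Perm Ctr) : Prop := ∀ y, rep g (0, y) = (0, homeP π y)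

theorem Rep.mul {g g' π π'} (h : Rep g π) (h' : Rep g' π') : Rep (g * g') (π * π') := by
  intro y
  rw [map_mul, Equiv.Perm.mul_apply, h', h, map_mul, Equiv.Perm.mul_apply]

theorem Rep.one : Rep 1 1 := by
  intro y
  simp

theorem Rep.inv {g π} (h : Rep g π) : Rep g⁻¹ π⁻¹ := by
  intro y
  rw [map_inv, Equiv.Perm.inv_eq_iff_eq, h, map_inv]
  simp

theorem Rep.pow {g π} (h : Rep g π) (n : ℕ) : Rep (g ^ n) (π ^ n) := by
  induction n with
  | zero => simpa using Rep.one
  | succ n ih => rw [pow_succ, pow_succ]; exact ih.mul h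

theorem Rep.zpow {g π} (h : Rep g π) (n : ℤ) : Rep (g ^ n) (π ^ n) := by
  cases n with
  | ofNat n => simpa using h.pow n
  | negSucc n => rw [zpow_negSucc, zpow_negSucc]; exact (h.pow _).inv

theorem Rep_B : Rep gB hb := fun y => by rw [rep_B]; rfl
theorem Rep_C : Rep gC hc := fun y => by rw [rep_C]; rfl
theorem Rep_D : Rep gD hd := fun y => by rw [rep_D]; rfl
theorem Rep_T : Rep gT ha := fun y => by
  have h1 := rep_A_pow_inv 1 (homeP ha y)
  rw [gT, map_mul, map_mul, Equiv.Perm.mul_apply, Equiv.Perm.mul_apply, rep_A, rep_C, pA_apply]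
  rw [show pC (0 + 1, y) = (((1 : ℕ) : ℤ), homeP ha y) from rfl]
  rw [pow_one] at h1
  exact h1

theorem hb_zpow (x : ℤ) (e n m : ℤ) : (hb ^ x) (e, n, m) = (e, n + x, m) := by
  induction x using Int.induction_on generalizing n with
  | zero => simp
  | succ k ih =>
    rw [zpow_add_one, Equiv.Perm.mul_apply, show hb (e, n, m) = (e, n + 1, m) from rfl, ih]
    simp; ring
  | pred k ih =>
    rw [zpow_sub_one, Equiv.Perm.mul_apply, show hb⁻¹ (e, n, m) = (e, n - 1, m) from rfl, ih]
    simp; ring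

theorem hc_zpow (x : ℤ) (e n m : ℤ) : (hc ^ x) (e, n, m) = (e, n, m + x) := by
  induction x using Int.induction_on generalizing m with
  | zero => simp
  | succ k ih =>
    rw [zpow_add_one, Equiv.Perm.mul_apply, show hc (e, n, m) = (e, n, m + 1) from rfl, ih]
    simp; ring
  | pred k ih =>
    rw [zpow_sub_one, Equiv.Perm.mul_apply, show hc⁻¹ (e, n, m) = (e, n, m - 1) from rfl, ih]
    simp; ring

/-- Labels of the automaton -/
inductive Lab | bc (x y : ℤ) | dd | al | er

open Lab

/-- group value of a label -/
def Lab.val : Lab → GP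
  | bc x y => gB ^ x * gC ^ y
  | dd => gD
  | al => gT
  | er => (gT * gD)⁻¹

/-- action of a label on counters -/
def Lab.act : Lab → Equiv.Perm Ctr
  | bc x y => hb ^ x * hc ^ y
  | dd => hd
  | al => ha
  | er => (ha * hd)⁻¹

theorem Lab.rep (l : Lab) : Rep l.val l.act := by
  cases l with
  | bc x y => exact (Rep_B.zpow x).mul (Rep_C.zpow y)
  | dd => exact Rep_D
  | al => exact Rep_T
  | er => exact (Rep_T.mul Rep_D).inv

section layer

variable {S : Type} [Encodable S]

/-- Generators of the submonoid of an automaton -/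
def gens (T : List (S × Lab × S)) : Set GP :=
  {g | ∃ t ∈ T, g = gU (Encodable.encode t.2.2) * t.2.1.val * (gU (Encodable.encode t.1))⁻¹}

/-- Steps on counters -/
def CStep (T : List (S × Lab × S)) (c c' : S × Ctr) : Prop :=
  ∃ l, (c.1, l, c'.1) ∈ T ∧ c'.2 = l.act c.2

/-- Steps on the group -/
def GStep (T : List (S × Lab × S)) (c c' : S × GP) : Prop :=
  ∃ l, (c.1, l, c'.1) ∈ T ∧ c'.2 = l.val * c.2

theorem up_pos (q p k : ℕ) : ∃ k', up q (pos p k) = pos p k' := by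
  simp only [up]
  split_ifs
  · exact ⟨_, rfl⟩
  · exact ⟨_, rfl⟩

theorem layer_sound {T : List (S × Lab × S)} {g : GP} (hg : g ∈ Submonoid.closure (gens T))
    {c₀ : S × Ctr} : ∀ {q : S} {k : ℕ} {h : Ctr}, Relation.ReflTransGen (CStep T) c₀ (q, h) →
      ∃ q' k' h', rep g (0, pos (Encodable.encode q) k, h) = (0, pos (Encodable.encode q') k', h') ∧
        Relation.ReflTransGen (CStep T) c₀ (q', h') := by
  induction hg using Submonoid.closure_induction with
  | one => intro q k h hr; exact ⟨q, k, h, by simp, hr⟩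
  | mul x y _ _ ihx ihy =>
    intro q k h hr
    obtain ⟨q1, k1, h1, e1, hr1⟩ := ihy (k := k) hr
    obtain ⟨q2, k2, h2, e2, hr2⟩ := ihx (k := k1) hr1
    exact ⟨q2, k2, h2, by rw [map_mul, Equiv.Perm.mul_apply, e1, e2], hr2⟩
  | mem x hx =>
    obtain ⟨⟨p, l, p'⟩, ht, rfl⟩ := hx
    intro q k h hr
    simp only [map_mul, Equiv.Perm.mul_apply, rep_U_inv]
    have stay : ∀ k₁, down (Encodable.encode p) (pos (Encodable.encode q) k) =
        pos (Encodable.encode q) k₁ → ∃ q' k' h', rep (gU (Encodable.encode p')) (rep l.val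
        (0, down (Encodable.encode p) (pos (Encodable.encode q) k), h)) =
          (0, pos (Encodable.encode q') k', h') ∧
        Relation.ReflTransGen (CStep T) c₀ (q', h') := by
      intro k₁ e
      rw [e, l.rep, homeP_ne _ (by simp), rep_U]
      obtain ⟨k', e'⟩ := up_pos (Encodable.encode p') (Encodable.encode q) k₁
      rw [e']
      exact ⟨q, k', h, rfl, hr⟩
    by_cases hpq : q = p
    · subst hpq
      cases k with
      | zero =>
        have e : down (Encodable.encode q) (pos (Encodable.encode q) 0) = home := by simp [down]
        rw [e, l.rep, homeP_home, rep_U]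
        exact ⟨p', 0, l.act h, rfl, hr.tail ⟨l, ht, rfl⟩⟩
      | succ k => exact stay k (by simp [down])
    · have hne : ¬ Encodable.encode q = Encodable.encode p :=
        fun h => hpq (Encodable.encode_injective h)
      exact stay k (by cases k <;> simp [down, hne])

theorem layer_complete {T : List (S × Lab × S)} {c c' : S × GP}
    (h : Relation.ReflTransGen (GStep T) c c') :
    gU (Encodable.encode c'.1) * (c'.2 * c.2⁻¹) * (gU (Encodable.encode c.1))⁻¹ ∈
      Submonoid.closure (gens T) := by
  induction h with
  | refl => simp
  | @tail c₁ c₂ _ h ih =>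
    obtain ⟨l, h1, h2⟩ := h
    have := mul_mem (Submonoid.subset_closure (s := gens T) ⟨_, h1, rfl⟩) ih
    convert this using 1
    rw [h2]
    group

end layer

/-! ### The automaton of an affine system -/

/-- States of the automaton -/
inductive St (Q : Type) | main (q : Q) | fwd (e : AEdge Q) | bwd (q : Q) | erase
  deriving Encodable

open St

/-- transitions of one edge -/
def etrans {Q : Type} (e : AEdge Q) : List (St Q × Lab × St Q) :=
  [(main e.1, bc (-(e.2.2.1 : ℤ)) e.2.2.2.2.1, fwd e),
   (fwd e, bc (-(e.2.1 : ℤ)) e.2.2.2.1, fwd e),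
   (fwd e, dd, bwd e.2.2.2.2.2),
   (bwd e.2.2.2.2.2, bc 1 (-1), bwd e.2.2.2.2.2),
   (bwd e.2.2.2.2.2, al, main e.2.2.2.2.2)]

/-- All transitions. -/
def trans {Q : Type} (E : List (AEdge Q)) (qf : Q) : List (St Q × Lab × St Q) :=
  (main qf, bc 0 0, erase) :: (erase, er, erase) :: E.flatMap etrans

/-- The invariant -/
def Inv {Q : Type} (E : List (AEdge Q)) (qf : Q) (c₀ : Q × ℕ) : St Q → Ctr → Prop
  | main q, (e, n, m) => 0 ≤ e ∧ (e = 0 → m = 0 ∧ ∃ N : ℕ, n = N ∧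
      Relation.ReflTransGen (AStep E) c₀ (q, N))
  | fwd (q, p, r, p', r', _), (e, n, m) => 0 ≤ e ∧ (e = 0 → ∃ N k : ℕ,
      Relation.ReflTransGen (AStep E) c₀ (q, N) ∧ n = N - r - p * k ∧ m = r' + p' * k)
  | bwd q, (e, n, m) => 0 ≤ e ∧ (e = 0 → ∃ N : ℕ, n + m = N ∧
      Relation.ReflTransGen (AStep E) c₀ (q, N))
  | erase, (e, n, m) => e = 0 → n = 0 → m = 0 → Relation.ReflTransGen (AStep E) c₀ (qf, 0)

theorem act_bc (x y e n m : ℤ) : (bc x y).act (e, n, m) = (e, n + x, m + y) := by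
  rw [Lab.act, Equiv.Perm.mul_apply, hc_zpow, hb_zpow]

theorem act_dd (e n m : ℤ) : dd.act (e, n, m) = (e + (if n = 0 then 0 else 1), n, m) := rfl

theorem act_al (e n m : ℤ) : al.act (e, n, m) = (e + (if m = 0 then 0 else 1), n, m) := rfl

theorem act_er (e n m : ℤ) : er.act (e, n, m) =
    (e - (if m = 0 then 0 else 1) - (if n = 0 then 0 else 1), n, m) := rfl

theorem inv_step {Q : Type} {E : List (AEdge Q)} {qf : Q} {c₀ : Q × ℕ} {c c' : St Q × Ctr}
    (h : CStep (trans E qf) c c') (hi : Inv E qf c₀ c.1 c.2) : Inv E qf c₀ c'.1 c'.2 := by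
  obtain ⟨s, e, n, m⟩ := c
  obtain ⟨s', h'⟩ := c'
  obtain ⟨l, hm, h2⟩ := h
  simp only at h2 hm hi ⊢
  subst h2
  simp only [trans, List.mem_cons, List.mem_flatMap, Prod.mk.injEq] at hm
  rcases hm with ⟨rfl, rfl, rfl⟩ | ⟨rfl, rfl, rfl⟩ | ⟨⟨q, p, r, p', r', q'⟩, hE, hm⟩
  · rw [act_bc]
    simp only [Inv] at hi ⊢
    intro h1 h2 h3
    obtain ⟨_, N, h4, h5⟩ := hi.2 h1
    obtain rfl : N = 0 := by omega
    exact h5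
  · rw [act_er]
    simp only [Inv] at hi ⊢
    intro h1 h2 h3
    rw [if_pos h2, if_pos h3] at h1
    exact hi (by omega) h2 h3
  · simp only [etrans, List.mem_cons, List.not_mem_nil, or_false, Prod.mk.injEq] at hm
    rcases hm with ⟨rfl, rfl, rfl⟩ | ⟨rfl, rfl, rfl⟩ | ⟨rfl, rfl, rfl⟩ | ⟨rfl, rfl, rfl⟩ |
      ⟨rfl, rfl, rfl⟩
    · rw [act_bc]
      simp only [Inv] at hi ⊢
      refine ⟨hi.1, fun h1 => ?_⟩
      obtain ⟨h2, N, h3, h4⟩ := hi.2 h1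
      exact ⟨N, 0, h4, by simp [h3]; ring, by simp [h2]⟩
    · rw [act_bc]
      simp only [Inv] at hi ⊢
      refine ⟨hi.1, fun h1 => ?_⟩
      obtain ⟨N, k, h2, h3, h4⟩ := hi.2 h1
      exact ⟨N, k + 1, h2, by rw [h3]; push_cast; ring, by rw [h4]; push_cast; ring⟩
    · rw [act_dd]
      simp only [Inv] at hi ⊢
      have h0 := hi.1
      by_cases hn : n = 0
      · rw [if_pos hn, add_zero]
        refine ⟨h0, fun h1 => ?_⟩
        obtain ⟨N, k, h2, h3, h4⟩ := hi.2 h1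
        refine ⟨p' * k + r', by rw [hn, h4]; push_cast; ring, h2.tail ⟨p, r, p', r', k, hE, ?_, rfl⟩⟩
        simp only
        zify
        linarith
      · rw [if_neg hn]
        exact ⟨by omega, fun h => by omega⟩
    · rw [act_bc]
      simp only [Inv] at hi ⊢
      refine ⟨hi.1, fun h1 => ?_⟩
      obtain ⟨N, h3, h4⟩ := hi.2 h1
      exact ⟨N, by rw [← h3]; ring, h4⟩
    · rw [act_al]
      simp only [Inv] at hi ⊢
      have h0 := hi.1
      by_cases hm : m = 0
      · rw [if_pos hm, add_zero]
        refine ⟨h0, fun h1 => ⟨hm, ?_⟩⟩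
        obtain ⟨N, h3, h4⟩ := hi.2 h1
        exact ⟨N, by omega, h4⟩
      · rw [if_neg hm]
        exact ⟨by omega, fun h => by omega⟩

theorem auto_sound {Q : Type} {E : List (AEdge Q)} {q₀ qf : Q} {N : ℕ}
    (h : Relation.ReflTransGen (CStep (trans E qf)) (main q₀, (0, (N : ℤ), 0)) (erase, (0, 0, 0))) :
    Relation.ReflTransGen (AStep E) (q₀, N) (qf, 0) := by
  have : ∀ c, Relation.ReflTransGen (CStep (trans E qf)) (main q₀, (0, (N : ℤ), 0)) c →
      Inv E qf (q₀, N) c.1 c.2 := by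
    intro c hc
    induction hc with
    | refl => exact ⟨le_rfl, fun _ => ⟨rfl, N, rfl, Relation.ReflTransGen.refl⟩⟩
    | tail _ h ih => exact inv_step h ih
  exact this _ h rfl rfl rfl

theorem loop_reach {S : Type} {T : List (S × Lab × S)} {q : S} {l : Lab} (h : (q, l, q) ∈ T)
    (x : GP) (k : ℕ) : Relation.ReflTransGen (GStep T) (q, x) (q, l.val ^ k * x) := by
  induction k with
  | zero => simpa using Relation.ReflTransGen.refl
  | succ k ih => exact ih.tail ⟨l, h, by simp [pow_succ', mul_assoc]⟩

theorem comm_zBC (x y : ℤ) : gB ^ x * gC ^ y = gC ^ y * gB ^ x :=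
  (comm_BC.zpow_zpow x y).eq

theorem bc_pow (x y : ℤ) (k : ℕ) : (bc x y).val ^ k = gB ^ (x * k) * gC ^ (y * k) := by
  rw [Lab.val, (comm_BC.zpow_zpow x y).mul_pow, ← zpow_natCast, ← zpow_natCast, zpow_mul, zpow_mul]

theorem bc_collect_aux {G : Type} [Group G] {B C : G} (hBC : Commute B C) (a b c d e : ℤ) (x : G) :
    B ^ a * C ^ b * (B ^ c * C ^ d * (B ^ e * x)) = B ^ (a + c + e) * (C ^ (b + d) * x) := by
  have h1 : C ^ b * B ^ c = B ^ c * C ^ b := (hBC.symm.zpow_zpow b c).eq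
  have h2 : C ^ (b + d) * B ^ e = B ^ e * C ^ (b + d) := (hBC.symm.zpow_zpow (b + d) e).eq
  calc B ^ a * C ^ b * (B ^ c * C ^ d * (B ^ e * x))
      = B ^ a * (C ^ b * B ^ c) * C ^ d * B ^ e * x := by simp only [mul_assoc]
    _ = B ^ a * B ^ c * (C ^ b * C ^ d * B ^ e) * x := by rw [h1]; simp only [mul_assoc]
    _ = B ^ a * B ^ c * (C ^ (b + d) * B ^ e) * x := by rw [zpow_add C b d]
    _ = B ^ (a + c + e) * (C ^ (b + d) * x) := by
      rw [h2, zpow_add B (a + c) e, zpow_add B a c, zpow_add C b d]; simp only [mul_assoc]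

theorem bc_collect (a b c d e : ℤ) (x : GP) :
    gB ^ a * gC ^ b * (gB ^ c * gC ^ d * (gB ^ e * x)) = gB ^ (a + c + e) * (gC ^ (b + d) * x) :=
  bc_collect_aux comm_BC a b c d e x

theorem auto_step {Q : Type} {E : List (AEdge Q)} {qf : Q} {c c' : Q × ℕ} (h : AStep E c c')
    (x : GP) : Relation.ReflTransGen (GStep (trans E qf)) (main c.1, gB ^ (c.2 : ℤ) * x)
      (main c'.1, gB ^ (c'.2 : ℤ) * (gT * gD * x)) := by
  obtain ⟨q, n⟩ := c
  obtain ⟨q', n'⟩ := c'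
  obtain ⟨p, r, p', r', k, hE, h1, h2⟩ := h
  simp only at hE h1 h2 ⊢
  have hT : ∀ t ∈ etrans (q, p, r, p', r', q'), t ∈ trans E qf := by
    intro t ht
    simp only [trans, List.mem_cons, List.mem_flatMap]
    exact Or.inr (Or.inr ⟨_, hE, ht⟩)
  have t1 := hT (main q, bc (-(r : ℤ)) r', fwd (q, p, r, p', r', q')) (by simp [etrans])
  have t2 := hT (fwd (q, p, r, p', r', q'), bc (-(p : ℤ)) p', fwd (q, p, r, p', r', q'))
    (by simp [etrans])
  have t3 := hT (fwd (q, p, r, p', r', q'), dd, bwd q') (by simp [etrans])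
  have t4 := hT (bwd q', bc 1 (-1), bwd q') (by simp [etrans])
  have t5 := hT (bwd q', al, main q') (by simp [etrans])
  have e1 : (bc (-(p : ℤ)) p').val ^ k * ((bc (-(r : ℤ)) r').val * (gB ^ (n : ℤ) * x)) =
      gC ^ (n' : ℤ) * x := by
    rw [bc_pow, Lab.val, h1, h2]
    rw [bc_collect]
    have a1 : -(p : ℤ) * k + -(r : ℤ) + ((p * k + r : ℕ) : ℤ) = 0 := by push_cast; ring
    have a2 : (p' : ℤ) * k + r' = ((p' * k + r' : ℕ) : ℤ) := by push_cast; ring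
    rw [a1, a2, zpow_zero, one_mul]
  have e2 : (bc 1 (-1)).val ^ n' * (gD * (gC ^ (n' : ℤ) * x)) = gB ^ (n' : ℤ) * (gD * x) := by
    rw [bc_pow, ← mul_assoc gD, ← (comm_CD.zpow_left (n' : ℤ)).eq]
    simp only [mul_assoc]
    rw [← mul_assoc (gC ^ _), ← zpow_add]
    simp
  refine Relation.ReflTransGen.head (b := (fwd (q, p, r, p', r', q'), _)) ⟨_, t1, rfl⟩ ?_
  refine (loop_reach t2 _ k).trans ?_
  simp only [e1]
  refine Relation.ReflTransGen.head (b := (bwd q', gD * (gC ^ (n' : ℤ) * x))) ⟨_, t3, rfl⟩ ?_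
  refine (loop_reach t4 _ n').trans ?_
  rw [e2]
  refine Relation.ReflTransGen.single ⟨_, t5, ?_⟩
  simp only [Lab.val]
  rw [← mul_assoc gT, ← (comm_BT.zpow_left (n' : ℤ)).eq]
  simp only [mul_assoc]

theorem auto_complete {Q : Type} {E : List (AEdge Q)} {q₀ qf : Q} {N : ℕ}
    (h : Relation.ReflTransGen (AStep E) (q₀, N) (qf, 0)) :
    Relation.ReflTransGen (GStep (trans E qf)) (main q₀, gB ^ (N : ℤ)) (erase, 1) := by
  have : ∀ c, Relation.ReflTransGen (AStep E) (q₀, N) c → ∃ j : ℕ,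
      Relation.ReflTransGen (GStep (trans E qf)) (main q₀, gB ^ (N : ℤ))
        (main c.1, gB ^ (c.2 : ℤ) * (gT * gD) ^ j) := by
    intro c hc
    induction hc with
    | refl => exact ⟨0, by simpa using Relation.ReflTransGen.refl⟩
    | tail _ h ih =>
      obtain ⟨j, ih⟩ := ih
      refine ⟨j + 1, ih.trans ?_⟩
      rw [pow_succ']
      exact auto_step h _
  obtain ⟨j, hj⟩ := this _ h
  refine hj.trans ?_
  refine Relation.ReflTransGen.head (b := (erase, (gT * gD) ^ j))
    ⟨bc 0 0, by simp [trans], by simp [Lab.val]⟩ ?_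
  have := loop_reach (T := trans E qf) (q := erase) (l := er) (by simp [trans]) ((gT * gD) ^ j) j
  have e : er.val ^ j * (gT * gD) ^ j = 1 := by
    rw [Lab.val, inv_pow, inv_mul_cancel]
  rwa [e] at this

theorem mem_iff {Q : Type} [Encodable Q] (E : List (AEdge Q)) (q₀ qf : Q) (N : ℕ) :
    gU (Encodable.encode (erase : St Q)) * gB⁻¹ ^ N * (gU (Encodable.encode (main q₀ : St Q)))⁻¹ ∈
      Submonoid.closure (gens (trans E qf)) ↔
      Relation.ReflTransGen (AStep E) (q₀, N) (qf, 0) := by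
  have hpow : gB⁻¹ ^ N = gB ^ (-(N : ℤ)) := by rw [zpow_neg, zpow_natCast, inv_pow]
  rw [hpow]
  constructor
  · intro h
    obtain ⟨q', k', h', e1, hr⟩ := layer_sound h (c₀ := (main q₀, (0, (N : ℤ), 0))) (k := 0)
      Relation.ReflTransGen.refl
    apply auto_sound
    simp only [map_mul, Equiv.Perm.mul_apply, rep_U_inv] at e1
    have e : down (Encodable.encode (main q₀ : St Q)) (pos (Encodable.encode (main q₀ : St Q)) 0) =
      home := by simp [down]
    rw [e] at e1
    have hB := Rep_B.zpow (-(N : ℤ))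
    rw [hB, homeP_home, hb_zpow, rep_U] at e1
    simp only [up, Prod.mk.injEq, pos.injEq, add_neg_cancel, true_and] at e1
    obtain ⟨⟨e2, _⟩, e3⟩ := e1
    have e4 := Encodable.encode_injective e2
    subst e4
    rw [← e3] at hr
    exact hr
  · intro h
    have := layer_complete (auto_complete h)
    rw [one_mul, ← zpow_neg] at this
    exact this

/-! ### The theorem -/

theorem wordEval_surjective : Function.Surjective wordEval := by
  rw [← MonoidHom.mrange_eq_top]
  have hgen : ∀ v : Fin 4, (PresentedGroup.of v : GP) ∈ MonoidHom.mrange wordEval := fun v =>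
    ⟨FreeMonoid.of (v, true), by simp [wordEval]⟩
  have hgeni : ∀ v : Fin 4, (PresentedGroup.of v : GP)⁻¹ ∈ MonoidHom.mrange wordEval := fun v =>
    ⟨FreeMonoid.of (v, false), by simp [wordEval]⟩
  rw [eq_top_iff]
  rintro x -
  obtain ⟨x, rfl⟩ := PresentedGroup.mk_surjective _ x
  induction x using FreeGroup.induction_on with
  | C1 => rw [map_one]; exact one_mem _
  | of v => exact hgen v
  | inv_of v _ => rw [map_inv]; exact hgeni v
  | mul x y hx hy => rw [map_mul]; exact mul_mem hx hy

theorem gens_finite {S : Type} [Encodable S] (T : List (S × Lab × S)) : (gens T).Finite := by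
  have : gens T = (fun t : S × Lab × S => gU (Encodable.encode t.2.2) * t.2.1.val *
      (gU (Encodable.encode t.1))⁻¹) '' {t | t ∈ T} := by
    ext g
    constructor
    · rintro ⟨t, h, rfl⟩; exact ⟨t, h, rfl⟩
    · rintro ⟨t, h, rfl⟩; exact ⟨t, h, rfl⟩
  rw [this]
  exact (List.finite_toSet T).image _

theorem computable_word {α : Type} [Primcodable α] {f : α → ℕ} (hf : Computable f)
    (u v : FreeMonoid (Fin 4 × Bool)) (x : Fin 4 × Bool) :
    Computable (fun a => u * FreeMonoid.of x ^ f a * v) := by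
  have h : Computable (fun a => (u.toList ++ (List.range (f a)).map (fun _ => x)) ++ v.toList) := by
    have h1 : Primrec (fun n : ℕ =>
        (u.toList ++ (List.range n).map (fun _ => x)) ++ v.toList) := by
      refine Primrec.list_append.comp (Primrec.list_append.comp (Primrec.const _) ?_)
        (Primrec.const _)
      exact Primrec.list_map Primrec.list_range (Primrec.const x).to₂
    exact h1.to_comp.comp hf
  refine Computable.of_eq (f := fun a => (FreeMonoid.ofList
    ((u.toList ++ (List.range (f a)).map (fun _ => x)) ++ v.toList))) h fun a => ?_
  apply FreeMonoid.toList.injective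
  have hrep : ∀ n : ℕ, List.replicate n x = FreeMonoid.toList (FreeMonoid.of x ^ n) := by
    intro n
    induction n with
    | zero => simp
    | succ n ih => rw [pow_succ', FreeMonoid.toList_mul, ← ih, FreeMonoid.toList_of,
        List.replicate_succ, List.singleton_append]
  simp [FreeMonoid.toList_mul, hrep]

end P4

/-- Lohrey–Steinberg. The right-angled Artin group `A(P₄)` contains a
finitely generated submonoid with undecidable membership problem: there is a finite set `S`
of words over the generators and their inverses such that no algorithm decides, for an input
word `w`, whether the image of `w` in `A(P₄)` lies in the submonoid generated by the images
of the words of `S`. -/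
theorem stmt_19 :
    ∃ S : Finset (FreeMonoid (Fin 4 × Bool)),
      ¬ ComputablePred (fun w : FreeMonoid (Fin 4 × Bool) =>
          wordEval w ∈ Submonoid.closure (wordEval '' (S : Set (FreeMonoid (Fin 4 × Bool))))) := by
  classical
  obtain ⟨Q, _, E, q₀, qf, f, hf, hE⟩ := P4.exists_affine
  choose φ hφ using P4.wordEval_surjective
  have hfin := P4.gens_finite (P4.trans E qf)
  refine ⟨hfin.toFinset.image φ, fun hdec => ?_⟩
  have himg : wordEval '' ((hfin.toFinset.image φ : Finset (FreeMonoid (Fin 4 × Bool))) :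
      Set (FreeMonoid (Fin 4 × Bool))) = P4.gens (P4.trans E qf) := by
    rw [Finset.coe_image, ← Set.image_comp, Set.Finite.coe_toFinset]
    have : wordEval ∘ φ = id := funext hφ
    rw [this, Set.image_id]
  rw [himg] at hdec
  apply ComputablePred.halting_problem 0
  have hw := P4.computable_word hf (φ (P4.gU (Encodable.encode (P4.St.erase : P4.St Q))))
    (φ (P4.gU (Encodable.encode (P4.St.main q₀ : P4.St Q)))⁻¹) (1, false)
  obtain ⟨inst, hdec⟩ := hdec
  have := (ComputablePred.computable_iff.2 ⟨_, hdec.comp hw, rfl⟩)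
  refine this.of_eq fun c => ?_
  rw [← hE c, ← P4.mem_iff, decide_eq_true_iff]
  beta_reduce
  rw [map_mul, map_mul, hφ, hφ, map_pow]
  have : wordEval (FreeMonoid.of (1, false)) = P4.gB⁻¹ := by simp [wordEval, P4.gB]
  rw [this]
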